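/- Under the Ader algorithm with horizon T (losses valued in [0,1], convex, G-Lipschitz gradients, domain diameter at most D), for every comparator sequence u_1,…,u_T ∈ Ω with path-length P_T = Σ_{t=1}^{T−1} ‖u_{t+1}−u_t‖₂, the dynamic regret satisfies Σ_{t=1}^T f_t(w_t) − Σ_{t=1}^T f_t(u_t) ≤ (3G/4)·√( 2T·(7D² + 4D·P_T) ) + (√(2T)/4)·( 1 + 2·ln(k+1) ), where k = ⌊ (1/2)·log₂(1 + 4P_T/(7D)) ⌋ + 1. -/

import Mathlib

/-- The number of experts of Ader with horizon `T`: `N = ⌈(1/2)log₂(1 + 4T/7)⌉ + 1`. -/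
noncomputable def aderN (T : ℕ) : ℕ := ⌈Real.logb 2 (1 + 4 * (T : ℝ) / 7) / 2⌉₊ + 1

/-- The `i`-th step size of Ader with horizon `T`: `η_i = 2^{i−1}(D/G)√(7/(2T))`. -/
noncomputable def aderEta (D G : ℝ) (T i : ℕ) : ℝ :=
  2 ^ (i - 1) * (D / G) * Real.sqrt (7 / (2 * (T : ℝ)))

/-- The Hedge learning rate of Ader with horizon `T`: `α = √(8/T)`. -/
noncomputable def aderAlpha (T : ℕ) : ℝ := Real.sqrt (8 / (T : ℝ))

section FirstOrder

variable {E : Type*} [NormedAddCommGroup E] [InnerProductSpace ℝ E]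

/-- First-order lower bound for a differentiable convex function. -/
theorem ConvexOn.sub_le_inner_gradient [CompleteSpace E] {f : E → ℝ}
    (hf : ConvexOn ℝ Set.univ f) {z : E} (hd : DifferentiableAt ℝ f z) (u : E) :
    f z - f u ≤ inner ℝ (gradient f z) (z - u) := by
  have hconv : ConvexOn ℝ Set.univ (f ∘ AffineMap.lineMap (k := ℝ) z u) := by
    simpa using hf.comp_affineMap (AffineMap.lineMap (k := ℝ) z u : ℝ →ᵃ[ℝ] E)
  have hderiv : HasDerivAt (f ∘ AffineMap.lineMap (k := ℝ) z u) (fderiv ℝ f z (u - z)) 0 := by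
    have hline : HasDerivAt (AffineMap.lineMap (k := ℝ) z u) (u - z) (0 : ℝ) :=
      AffineMap.hasDerivAt_lineMap
    refine HasFDerivAt.comp_hasDerivAt (0 : ℝ) ?_ hline
    simpa using hd.hasFDerivAt
  have hslope := hconv.le_slope_of_hasDerivAt (Set.mem_univ 0) (Set.mem_univ 1) one_pos hderiv
  have hneg : inner ℝ (gradient f z) (z - u) = -fderiv ℝ f z (u - z) := by
    rw [inner_gradient_left, ← map_neg, neg_sub]
  simp [slope_def_field] at hslope
  simp only [map_sub] at hneg
  linarith

/-- Moving to a nearest point of a convex set does not increase distances to that set. -/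
theorem Convex.norm_nearest_sub_le {K : Set E} (hK : Convex ℝ K) {z v u : E} (hv : v ∈ K)
    (hmin : ∀ z' ∈ K, ‖v - z‖ ≤ ‖z' - z‖) (hu : u ∈ K) : ‖v - u‖ ≤ ‖z - u‖ := by
  have : Nonempty K := ⟨⟨v, hv⟩⟩
  have hinf : ‖z - v‖ = ⨅ w : K, ‖z - w‖ := by
    refine le_antisymm (le_ciInf fun w => ?_)
      (ciInf_le ⟨0, Set.forall_mem_range.2 fun w : K => norm_nonneg (z - w)⟩ (⟨v, hv⟩ : K))
    rw [norm_sub_rev z v, norm_sub_rev z w]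
    exact hmin w w.2
  have hinner := (norm_eq_iInf_iff_real_inner_le_zero hK hv).1 hinf u hu
  have hsplit : ‖z - u‖ ^ 2 = ‖z - v‖ ^ 2 - 2 * inner ℝ (z - v) (u - v) + ‖u - v‖ ^ 2 := by
    rw [← norm_sub_sq_real, sub_sub_sub_cancel_right]
  rw [norm_sub_rev v u]
  exact le_of_sq_le_sq (by nlinarith [sq_nonneg ‖z - v‖]) (norm_nonneg _)

/-- Dynamic regret of projected online gradient descent with a constant step size. -/
theorem ogd_dynamic_regret [CompleteSpace E] {K : Set E} (hK : Convex ℝ K) {D G η : ℝ}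
    (hη : 0 ≤ η) (hdiam : ∀ z ∈ K, ∀ z' ∈ K, ‖z - z'‖ ≤ D) {f : ℕ → E → ℝ}
    (hfconv : ∀ t, ConvexOn ℝ Set.univ (f t)) (hfdiff : ∀ t z, DifferentiableAt ℝ (f t) z)
    (hgrad : ∀ t, ∀ z ∈ K, ‖gradient (f t) z‖ ≤ G) {proj : E → E}
    (hproj : ∀ z, proj z ∈ K ∧ ∀ z' ∈ K, ‖proj z - z‖ ≤ ‖z' - z‖) {y : ℕ → E}
    (hy : ∀ t, 1 ≤ t → y t ∈ K)
    (hyup : ∀ t, 1 ≤ t → y (t + 1) = proj (y t - η • gradient (f t) (y t)))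
    {T : ℕ} (hT : 1 ≤ T) {u : ℕ → E} (hu : ∀ t, 1 ≤ t → t ≤ T → u t ∈ K) :
    2 * η * ∑ t ∈ Finset.Icc 1 T, (f t (y t) - f t (u t))
      ≤ D ^ 2 + 2 * D * ∑ t ∈ Finset.Ico 1 T, ‖u (t + 1) - u t‖ + T * (η ^ 2 * G ^ 2) := by
  have step : ∀ t, 1 ≤ t → t ≤ T →
      2 * η * (f t (y t) - f t (u t)) + ‖y (t + 1) - u t‖ ^ 2
        ≤ ‖y t - u t‖ ^ 2 + η ^ 2 * G ^ 2 := by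
    intro t h1 hT
    set g := gradient (f t) (y t)
    have hnear : ‖y (t + 1) - u t‖ ≤ ‖y t - η • g - u t‖ := by
      rw [hyup t h1]
      exact hK.norm_nearest_sub_le (hproj _).1 (hproj _).2 (hu t h1 hT)
    have hfirst : f t (y t) - f t (u t) ≤ inner ℝ g (y t - u t) :=
      (hfconv t).sub_le_inner_gradient (hfdiff t _) _
    have hexpand : ‖y t - η • g - u t‖ ^ 2
        = ‖y t - u t‖ ^ 2 - 2 * (η * inner ℝ g (y t - u t)) + η ^ 2 * ‖g‖ ^ 2 := by
      rw [sub_right_comm, norm_sub_sq_real, inner_smul_right, real_inner_comm, norm_smul,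
        mul_pow, Real.norm_eq_abs, sq_abs]
    have hsq := pow_le_pow_left₀ (norm_nonneg _) hnear 2
    have hg : ‖g‖ ^ 2 ≤ G ^ 2 := pow_le_pow_left₀ (norm_nonneg _) (hgrad t _ (hy t h1)) 2
    nlinarith [mul_le_mul_of_nonneg_left hfirst hη, mul_le_mul_of_nonneg_left hg (sq_nonneg η)]
  suffices h : ∀ n, 1 ≤ n → n ≤ T →
      2 * η * ∑ t ∈ Finset.Icc 1 n, (f t (y t) - f t (u t)) + ‖y (n + 1) - u n‖ ^ 2
        ≤ D ^ 2 + 2 * D * ∑ t ∈ Finset.Ico 1 n, ‖u (t + 1) - u t‖ + n * (η ^ 2 * G ^ 2) by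
    linarith [h T hT le_rfl, sq_nonneg ‖y (T + 1) - u T‖]
  intro n hn
  induction n, hn using Nat.le_induction with
  | base =>
    intro h
    have hD := pow_le_pow_left₀ (norm_nonneg _)
      (hdiam _ (hy 1 le_rfl) _ (hu 1 le_rfl h)) 2
    simpa using (step 1 le_rfl h).trans (by gcongr)
  | succ n hn ih =>
    intro h
    have hn' : n ≤ T := by lia
    have hyn := hy (n + 1) (by lia)
    have hcur := hdiam _ hyn _ (hu n hn hn')
    have hnext := hdiam _ hyn _ (hu (n + 1) (by lia) h)
    have htri : ‖y (n + 1) - u (n + 1)‖ ≤ ‖y (n + 1) - u n‖ + ‖u (n + 1) - u n‖ := by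
      rw [norm_sub_rev (u (n + 1))]
      exact norm_sub_le_norm_sub_add_norm_sub _ _ _
    have hshift : ‖y (n + 1) - u (n + 1)‖ ^ 2
        ≤ ‖y (n + 1) - u n‖ ^ 2 + 2 * D * ‖u (n + 1) - u n‖ := by
      nlinarith [norm_nonneg (y (n + 1) - u (n + 1)), norm_nonneg (y (n + 1) - u n),
        norm_nonneg (u (n + 1) - u n)]
    rw [Finset.sum_Icc_succ_top (by lia), Finset.sum_Ico_succ_top hn]
    push_cast
    linarith [ih hn', step (n + 1) (by lia) h]

end FirstOrder

section Hedge

variable {ι : Type*}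

open MeasureTheory ProbabilityTheory in
/-- Hoeffding's lemma for a finitely supported distribution on `[0, 1]`. -/
theorem sum_mul_exp_le_hoeffding (s : Finset ι) {p x : ι → ℝ} (hp : ∀ i ∈ s, 0 ≤ p i)
    (hsum : ∑ i ∈ s, p i = 1) (hx : ∀ i ∈ s, 0 ≤ x i ∧ x i ≤ 1) (a : ℝ) :
    ∑ i ∈ s, p i * Real.exp (a * x i) ≤ Real.exp (a * ∑ i ∈ s, p i * x i + a ^ 2 / 8) := by
  let _ : MeasurableSpace ι := ⊤
  let μ : Measure ι := ∑ i ∈ s, ENNReal.ofReal (p i) • Measure.dirac i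
  have hμ : IsProbabilityMeasure μ := ⟨by
    simp [μ, ← ENNReal.ofReal_sum_of_nonneg hp, hsum]⟩
  have hint : ∀ g : ι → ℝ, ∫ i, g i ∂μ = ∑ i ∈ s, p i * g i := by
    intro g
    rw [integral_finsetSum_measure fun i _ =>
      (integrable_dirac (by simp)).smul_measure ENNReal.ofReal_ne_top]
    refine Finset.sum_congr rfl fun i hi => ?_
    rw [integral_smul_measure, integral_dirac, ENNReal.toReal_ofReal (hp i hi), smul_eq_mul]
  have hae : ∀ᵐ i ∂μ, x i ∈ Set.Icc (0 : ℝ) 1 := by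
    rw [ae_finsetSum_measure_iff]
    intro i hi
    exact Measure.ae_smul_measure (by simpa [ae_dirac_eq] using hx i hi) _
  have hmgf := (hasSubgaussianMGF_of_mem_Icc
    (measurable_from_top (f := x)).aemeasurable hae).mgf_le a
  rw [mgf, hint, hint] at hmgf
  set m := ∑ i ∈ s, p i * x i
  calc ∑ i ∈ s, p i * Real.exp (a * x i)
      = Real.exp (a * m) * ∑ i ∈ s, p i * Real.exp (a * (x i - m)) := by
        rw [Finset.mul_sum]
        refine Finset.sum_congr rfl fun i _ => ?_
        rw [mul_left_comm, ← Real.exp_add]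
        ring_nf
    _ ≤ Real.exp (a * m) * Real.exp (a ^ 2 / 8) := by
        gcongr
        refine hmgf.trans_eq ?_
        norm_num
        ring
    _ = _ := (Real.exp_add _ _).symm

variable {s : Finset ι} {α : ℝ} {loss p : ℕ → ι → ℝ}

/-- Hedge weights stay positive and normalized. -/
theorem hedge_weights_pos_sum_one (hs : s.Nonempty) (hpos : ∀ i ∈ s, 0 < p 1 i)
    (hsum : ∑ i ∈ s, p 1 i = 1)
    (hup : ∀ t, 1 ≤ t → ∀ i, p (t + 1) i =
      p t i * Real.exp (-α * loss t i) / ∑ j ∈ s, p t j * Real.exp (-α * loss t j))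
    {t : ℕ} (ht : 1 ≤ t) : (∀ i ∈ s, 0 < p t i) ∧ ∑ i ∈ s, p t i = 1 := by
  induction t, ht using Nat.le_induction with
  | base => exact ⟨hpos, hsum⟩
  | succ t ht ih =>
    have hterm : ∀ i ∈ s, 0 < p t i * Real.exp (-α * loss t i) := fun i hi =>
      mul_pos (ih.1 i hi) (Real.exp_pos _)
    have hZ := Finset.sum_pos hterm hs
    simp only [hup t ht]
    exact ⟨fun i hi => div_pos (hterm i hi) hZ, by rw [← Finset.sum_div, div_self hZ.ne']⟩

/-- Regret of Hedge against a fixed expert, for losses in `[0, 1]`. -/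
theorem hedge_regret (hpos : ∀ i ∈ s, 0 < p 1 i) (hsum : ∑ i ∈ s, p 1 i = 1)
    (hup : ∀ t, 1 ≤ t → ∀ i, p (t + 1) i =
      p t i * Real.exp (-α * loss t i) / ∑ j ∈ s, p t j * Real.exp (-α * loss t j))
    (hloss : ∀ t, 1 ≤ t → ∀ i ∈ s, 0 ≤ loss t i ∧ loss t i ≤ 1) {k : ι} (hk : k ∈ s) (n : ℕ) :
    α * ∑ t ∈ Finset.Icc 1 n, (∑ i ∈ s, p t i * loss t i - loss t k)
      ≤ -Real.log (p 1 k) + n * (α ^ 2 / 8) := by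
  have hw := fun {t : ℕ} (ht : 1 ≤ t) => hedge_weights_pos_sum_one ⟨k, hk⟩ hpos hsum hup ht
  suffices h : α * ∑ t ∈ Finset.Icc 1 n, (∑ i ∈ s, p t i * loss t i - loss t k)
      ≤ Real.log (p (n + 1) k) - Real.log (p 1 k) + n * (α ^ 2 / 8) by
    have hn := hw (Nat.le_add_left 1 n)
    have hle : p (n + 1) k ≤ 1 :=
      (Finset.single_le_sum (fun i hi => (hn.1 i hi).le) hk).trans_eq hn.2
    linarith [Real.log_nonpos (hn.1 k hk).le hle]
  induction n with
  | zero => simp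
  | succ n ih =>
    obtain ⟨hwpos, hwsum⟩ := hw (Nat.le_add_left 1 n)
    have hZpos : 0 < ∑ j ∈ s, p (n + 1) j * Real.exp (-α * loss (n + 1) j) :=
      Finset.sum_pos (fun i hi => mul_pos (hwpos i hi) (Real.exp_pos _)) ⟨k, hk⟩
    have hZ := Real.log_le_log hZpos (sum_mul_exp_le_hoeffding s (fun i hi => (hwpos i hi).le)
      hwsum (hloss (n + 1) (by lia)) (-α))
    rw [Real.log_exp] at hZ
    rw [Finset.sum_Icc_succ_top (by lia), hup (n + 1) (by lia) k,
      Real.log_div (mul_pos (hwpos k hk) (Real.exp_pos _)).ne' hZpos.ne',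
      Real.log_mul (hwpos k hk).ne' (Real.exp_ne_zero _), Real.log_exp]
    push_cast
    linarith

end Hedge

theorem sum_Icc_inv_mul_succ (n : ℕ) :
    ∑ i ∈ Finset.Icc 1 n, 1 / ((i : ℝ) * ((i : ℝ) + 1)) = n / (n + 1) := by
  induction n with
  | zero => simp
  | succ n ih =>
    rw [Finset.sum_Icc_succ_top (by lia), ih]
    push_cast
    field_simp
    ring

/-- The dyadic exponent `F = ⌊(1/2)log₂ x⌋` satisfies `2 ^ F ≤ √x ≤ 2 * 2 ^ F`. -/
theorem two_pow_floor_half_logb_bounds {x : ℝ} (hx : 1 ≤ x) :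
    (2 : ℝ) ^ ⌊Real.logb 2 x / 2⌋₊ ≤ Real.sqrt x ∧
      Real.sqrt x ≤ 2 * 2 ^ ⌊Real.logb 2 x / 2⌋₊ := by
  have hx0 : 0 < x := by linarith
  have hsqrt : Real.sqrt x = (2 : ℝ) ^ (Real.logb 2 x / 2) := by
    rw [Real.sqrt_eq_rpow, div_eq_mul_one_div (Real.logb 2 x), Real.rpow_mul zero_le_two,
      Real.rpow_logb two_pos (by norm_num) hx0]
  have hlog : 0 ≤ Real.logb 2 x / 2 := div_nonneg (Real.logb_nonneg one_lt_two hx) zero_le_two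
  rw [hsqrt, ← pow_succ', ← Real.rpow_natCast, ← Real.rpow_natCast]
  refine ⟨Real.rpow_le_rpow_of_exponent_le one_le_two (Nat.floor_le hlog),
    Real.rpow_le_rpow_of_exponent_le one_le_two ?_⟩
  push_cast
  exact (Nat.lt_floor_add_one _).le

/-- The dyadic step size nearest below the optimal one loses a factor at most `3 / 2`. -/
theorem regret_le_of_dyadic_step {D G P T r s c R : ℝ} (hD : 0 < D) (hG : 0 < G) (hT : 0 < T)
    (hr : 0 < r) (hr2 : r ^ 2 = 7 / (2 * T)) (hs2 : s ^ 2 = 1 + 4 * P / (7 * D)) (hc : 0 < c)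
    (hcs : c ≤ s) (hsc : s ≤ 2 * c)
    (hR : 2 * (c * (D / G) * r) * R ≤ D ^ 2 + 2 * D * P + T * ((c * (D / G) * r) ^ 2 * G ^ 2)) :
    R ≤ 3 * G / 4 * Real.sqrt (2 * T * (7 * D ^ 2 + 4 * D * P)) := by
  have hs : 0 < s := hc.trans_le hcs
  have hP : 7 * D ^ 2 + 4 * D * P = 7 * D ^ 2 * s ^ 2 := by
    rw [hs2]
    field_simp
  have hTr : T * r ^ 2 = 7 / 2 := by
    rw [hr2]
    field_simp
  have hsqrt : Real.sqrt (2 * T * (7 * D ^ 2 + 4 * D * P)) = 2 * D * s * T * r := by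
    rw [hP, Real.sqrt_eq_iff_mul_self_eq_of_pos (by positivity)]
    linear_combination (4 * D ^ 2 * s ^ 2 * T) * hTr
  have hηG : T * ((c * (D / G) * r) ^ 2 * G ^ 2) = 7 / 2 * c ^ 2 * D ^ 2 := by
    rw [← hTr]
    field_simp
  have hbest : 2 * (c * (D / G) * r) * (3 * G / 4 * (2 * D * s * T * r))
      = 21 / 2 * (c * s * D ^ 2) := by
    rw [show 2 * (c * (D / G) * r) * (3 * G / 4 * (2 * D * s * T * r))
      = 3 * (T * r ^ 2) * (c * s * D ^ 2) by field_simp; ring, hTr]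
    ring
  have hcross : 0 ≤ D ^ 2 * ((s - c) * (2 * c - s)) :=
    mul_nonneg (sq_nonneg D) (mul_nonneg (by linarith) (by linarith))
  rw [hsqrt]
  refine le_of_mul_le_mul_left (hR.trans ?_) (show 0 < 2 * (c * (D / G) * r) by positivity)
  rw [hbest, hηG]
  nlinarith [sq_nonneg D, mul_nonneg (sq_nonneg D) (sq_nonneg c)]

/-- Theorem 8, dynamic regret of Ader: `y i` is the OGD expert run
with step size `η_i`, `p t i` its Hedge weight at round `t` (initialized
nonuniformly as `C/(i(i+1))` with `C = 1 + 1/N` and updated with learning rate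
`α = √(8/T)`), and Ader plays `w t = Σᵢ p t i • y i t`.  For every comparator
sequence `u` in `Ω` with path-length `P_T`, the dynamic regret of Ader is at most
`(3G/4)√(2T(7D² + 4DP_T)) + (√(2T)/4)(1 + 2ln(k+1))` with
`k = ⌊(1/2)log₂(1 + 4P_T/(7D))⌋ + 1`. -/
theorem ader_dynamic_regret
    (d T : ℕ) (hT : 1 ≤ T) (D G : ℝ)
    (Ω : Set (EuclideanSpace ℝ (Fin d)))
    (hne : Ω.Nonempty) (hcomp : IsCompact Ω) (hconv : Convex ℝ Ω)
    (hdiam : ∀ z ∈ Ω, ∀ z' ∈ Ω, ‖z - z'‖ ≤ D)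
    (f : ℕ → EuclideanSpace ℝ (Fin d) → ℝ)
    (hfconv : ∀ t, ConvexOn ℝ Set.univ (f t))
    (hfdiff : ∀ t z, DifferentiableAt ℝ (f t) z)
    (hgrad : ∀ t, ∀ z ∈ Ω, ‖gradient (f t) z‖ ≤ G)
    (hrange : ∀ t, ∀ z ∈ Ω, 0 ≤ f t z ∧ f t z ≤ 1)
    (proj : EuclideanSpace ℝ (Fin d) → EuclideanSpace ℝ (Fin d))
    (hproj : ∀ z, proj z ∈ Ω ∧ ∀ z' ∈ Ω, ‖proj z - z‖ ≤ ‖z' - z‖)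
    (y : ℕ → ℕ → EuclideanSpace ℝ (Fin d))
    (hy1 : ∀ i, y i 1 ∈ Ω)
    (hyup : ∀ i t, 1 ≤ t →
      y i (t + 1) = proj (y i t - aderEta D G T i • gradient (f t) (y i t)))
    (p : ℕ → ℕ → ℝ)
    (hp1 : ∀ i, 1 ≤ i → i ≤ aderN T →
      p 1 i = (1 + 1 / (aderN T : ℝ)) / ((i : ℝ) * ((i : ℝ) + 1)))
    (hpup : ∀ i t, 1 ≤ t →
      p (t + 1) i = p t i * Real.exp (-(aderAlpha T) * f t (y i t)) /
        ∑ j ∈ Finset.Icc 1 (aderN T), p t j * Real.exp (-(aderAlpha T) * f t (y j t)))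
    (w : ℕ → EuclideanSpace ℝ (Fin d))
    (hw : ∀ t, 1 ≤ t → w t = ∑ i ∈ Finset.Icc 1 (aderN T), p t i • y i t)
    (u : ℕ → EuclideanSpace ℝ (Fin d))
    (hu : ∀ t, 1 ≤ t → t ≤ T → u t ∈ Ω)
    (P : ℝ) (hP : P = ∑ t ∈ Finset.Ico 1 T, ‖u (t + 1) - u t‖) :
    ∑ t ∈ Finset.Icc 1 T, f t (w t) - ∑ t ∈ Finset.Icc 1 T, f t (u t)
      ≤ 3 * G / 4 * Real.sqrt (2 * (T : ℝ) * (7 * D ^ 2 + 4 * D * P))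
        + Real.sqrt (2 * (T : ℝ)) / 4 *
            (1 + 2 * Real.log (((⌊Real.logb 2 (1 + 4 * P / (7 * D)) / 2⌋₊ + 1 : ℕ) : ℝ) + 1)) := by
  have hT0 : (0 : ℝ) < T := by exact_mod_cast hT
  obtain ⟨z₀, hz₀⟩ := hne
  have hD0 : 0 ≤ D := (norm_nonneg _).trans (hdiam z₀ hz₀ z₀ hz₀)
  have hG0 : 0 ≤ G := (norm_nonneg _).trans (hgrad 0 z₀ hz₀)
  have hy : ∀ i t, 1 ≤ t → y i t ∈ Ω := by
    intro i t ht
    obtain rfl | ht := ht.eq_or_lt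
    · exact hy1 i
    · obtain ⟨m, rfl⟩ := Nat.exists_eq_add_of_lt ht
      rw [hyup i (1 + m) (by lia)]
      exact (hproj _).1
  set N := aderN T
  have hN1 : 1 ≤ N := Nat.le_add_left 1 _
  have hN0 : (0 : ℝ) < N := by exact_mod_cast hN1
  have hpos : ∀ i ∈ Finset.Icc 1 N, 0 < p 1 i := by
    intro i hi
    obtain ⟨hi1, hiN⟩ := Finset.mem_Icc.1 hi
    have : (0 : ℝ) < i := by exact_mod_cast hi1
    rw [hp1 i hi1 hiN]
    positivity
  have hsum : ∑ i ∈ Finset.Icc 1 N, p 1 i = 1 := by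
    calc ∑ i ∈ Finset.Icc 1 N, p 1 i
        = ∑ i ∈ Finset.Icc 1 N, (1 + 1 / (N : ℝ)) * (1 / ((i : ℝ) * ((i : ℝ) + 1))) := by
          refine Finset.sum_congr rfl fun i hi => ?_
          rw [hp1 i (Finset.mem_Icc.1 hi).1 (Finset.mem_Icc.1 hi).2, mul_one_div]
      _ = 1 := by
          rw [← Finset.mul_sum, sum_Icc_inv_mul_succ]
          field_simp
  have hhedge : ∀ t, 1 ≤ t → ∀ i, p (t + 1) i = p t i * Real.exp (-aderAlpha T * f t (y i t)) /
      ∑ j ∈ Finset.Icc 1 N, p t j * Real.exp (-aderAlpha T * f t (y j t)) :=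
    fun t ht i => hpup i t ht
  have hweights := fun {t : ℕ} (ht : 1 ≤ t) => hedge_weights_pos_sum_one
    (loss := fun t i => f t (y i t)) (Finset.nonempty_Icc.2 hN1) hpos hsum hhedge ht
  have hwΩ : ∀ t, 1 ≤ t → w t ∈ Ω := by
    intro t ht
    rw [hw t ht]
    exact hconv.sum_mem (fun i hi => ((hweights ht).1 i hi).le) (hweights ht).2
      fun i _ => hy i t ht
  have hP0 : 0 ≤ P := hP ▸ Finset.sum_nonneg fun _ _ => norm_nonneg _
  set F := ⌊Real.logb 2 (1 + 4 * P / (7 * D)) / 2⌋₊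
  have hlogk : 0 ≤ Real.log (((F + 1 : ℕ) : ℝ) + 1) := by
    refine Real.log_nonneg ?_
    push_cast
    linarith [Nat.cast_nonneg (α := ℝ) F]
  rw [← Finset.sum_sub_distrib]
  obtain hDG | hDG := (mul_nonneg hG0 hD0).eq_or_lt
  · refine (Finset.sum_nonpos fun t ht => ?_).trans (by positivity)
    obtain ⟨ht1, htT⟩ := Finset.mem_Icc.1 ht
    calc f t (w t) - f t (u t)
        ≤ inner ℝ (gradient (f t) (w t)) (w t - u t) :=
          (hfconv t).sub_le_inner_gradient (hfdiff t _) _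
      _ ≤ ‖gradient (f t) (w t)‖ * ‖w t - u t‖ := real_inner_le_norm _ _
      _ ≤ G * D := mul_le_mul (hgrad t _ (hwΩ t ht1)) (hdiam _ (hwΩ t ht1) _ (hu t ht1 htT))
          (norm_nonneg _) hG0
      _ = 0 := hDG.symm
  have hD : 0 < D := pos_of_mul_pos_right hDG hG0
  have hG : 0 < G := pos_of_mul_pos_left hDG hD0
  have hratio : P / D ≤ T := by
    rw [div_le_iff₀ hD, hP]
    calc ∑ t ∈ Finset.Ico 1 T, ‖u (t + 1) - u t‖
        ≤ ∑ _t ∈ Finset.Ico 1 T, D := by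
          refine Finset.sum_le_sum fun t ht => ?_
          obtain ⟨ht1, htT⟩ := Finset.mem_Ico.1 ht
          exact hdiam _ (hu _ (by lia) htT) _ (hu _ ht1 htT.le)
      _ ≤ T * D := by
          rw [Finset.sum_const, Nat.card_Ico, nsmul_eq_mul]
          gcongr
          exact Nat.sub_le T 1
  have hx : 1 ≤ 1 + 4 * P / (7 * D) := le_add_of_nonneg_right (by positivity)
  have hkmem : F + 1 ∈ Finset.Icc 1 N := by
    refine Finset.mem_Icc.2 ⟨by lia, Nat.add_le_add_right ((Nat.floor_le_ceil _).trans ?_) 1⟩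
    refine Nat.ceil_mono (div_le_div_of_nonneg_right ?_ zero_le_two)
    refine Real.logb_le_logb_of_le one_lt_two (by linarith) ?_
    rw [show 4 * P / (7 * D) = 4 * (P / D) / 7 by field_simp]
    gcongr
  obtain ⟨hFs, hsF⟩ := two_pow_floor_half_logb_bounds hx
  have hη : aderEta D G T (F + 1) = 2 ^ F * (D / G) * Real.sqrt (7 / (2 * T)) := rfl
  have hη0 : 0 ≤ aderEta D G T (F + 1) := by
    rw [hη]
    positivity
  have hogd := ogd_dynamic_regret hconv hη0 hdiam hfconv hfdiff hgrad hproj (hy (F + 1))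
    (hyup (F + 1)) hT hu
  rw [← hP, hη] at hogd
  have hexpert := regret_le_of_dyadic_step hD hG hT0 (by positivity)
    (Real.sq_sqrt (by positivity)) (Real.sq_sqrt (by linarith)) (by positivity) hFs hsF hogd
  have hmeta := hedge_regret (loss := fun t i => f t (y i t)) hpos hsum hhedge
    (fun t ht i _ => hrange t _ (hy i t ht)) hkmem T
  have hprior : -Real.log (p 1 (F + 1)) ≤ 2 * Real.log (((F + 1 : ℕ) : ℝ) + 1) := by
    obtain ⟨hk1, hkN⟩ := Finset.mem_Icc.1 hkmem
    have hk0 : (0 : ℝ) < (F + 1 : ℕ) := by positivity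
    rw [hp1 _ hk1 hkN, ← Real.log_inv, ← Nat.cast_two, ← Real.log_pow]
    refine Real.log_le_log (by positivity) ?_
    rw [inv_div, div_le_iff₀ (by positivity)]
    have : 0 ≤ 1 / (N : ℝ) := by positivity
    nlinarith [mul_nonneg (sq_nonneg (((F + 1 : ℕ) : ℝ) + 1)) this]
  have hα : aderAlpha T * (Real.sqrt (2 * T) / 4) = 1 := by
    rw [aderAlpha, ← mul_div_assoc, ← Real.sqrt_mul (by positivity),
      show 8 / (T : ℝ) * (2 * T) = 4 ^ 2 by field_simp; norm_num,
      Real.sqrt_sq (by norm_num), div_self (by norm_num)]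
  have hα2 : (T : ℝ) * (aderAlpha T ^ 2 / 8) = 1 := by
    rw [aderAlpha, Real.sq_sqrt (by positivity)]
    field_simp
  have hmix : ∑ t ∈ Finset.Icc 1 T, (f t (w t) - f t (y (F + 1) t))
      ≤ Real.sqrt (2 * T) / 4 * (1 + 2 * Real.log (((F + 1 : ℕ) : ℝ) + 1)) := by
    calc ∑ t ∈ Finset.Icc 1 T, (f t (w t) - f t (y (F + 1) t))
        ≤ ∑ t ∈ Finset.Icc 1 T,
            (∑ i ∈ Finset.Icc 1 N, p t i * f t (y i t) - f t (y (F + 1) t)) := by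
          refine Finset.sum_le_sum fun t ht => sub_le_sub_right ?_ _
          have ht1 := (Finset.mem_Icc.1 ht).1
          rw [hw t ht1]
          exact (hfconv t).map_sum_le (fun i hi => ((hweights ht1).1 i hi).le) (hweights ht1).2
            fun i _ => Set.mem_univ _
      _ = Real.sqrt (2 * T) / 4 * (aderAlpha T * ∑ t ∈ Finset.Icc 1 T,
            (∑ i ∈ Finset.Icc 1 N, p t i * f t (y i t) - f t (y (F + 1) t))) := by
          rw [← mul_assoc, mul_comm (Real.sqrt (2 * T) / 4), hα, one_mul]
      _ ≤ _ := by
          gcongr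
          linarith
  simp only [Finset.sum_sub_distrib] at hexpert hmix ⊢
  linarith
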